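/- (Proposition 1: void probability of a GLMB.) Let π be a GLMB density and let S ⊆ 𝕏 be a measurable region. Then the void probability functional of π on S, defined as the set integral of π over the region (𝕏∖S)×𝕃, is given in closed form by Q_π(S) = ∑_{L⊆𝕃} ∑_{c∈ℂ} w^(c)(L) ∏_{ℓ∈L} ⟨1 − 1_S, p^(c)(·,ℓ)⟩, where ⟨1 − 1_S, p^(c)(·,ℓ)⟩ = ∫_{𝕏∖S} p^(c)(x,ℓ) dx. -/

import Mathlib

open MeasureTheory ENNReal

/-- An injective `Fin n`-indexed family with range `J` is the same as an enumeration of `J`. -/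
noncomputable def injectiveImageEquiv {L : Type*} [DecidableEq L] (n : ℕ) (J : Finset L) :
    {f : Fin n → L // Function.Injective f ∧ Finset.image f Finset.univ = J} ≃ (Fin n ≃ J) where
  toFun f := (Equiv.ofInjective f.1 f.2.1).trans
    (Equiv.subtypeEquivRight fun x => by simp [← f.2.2])
  invFun e := ⟨fun i => e i, Subtype.val_injective.comp e.injective, by
    ext x
    simp only [Finset.mem_image, Finset.mem_univ, true_and]
    exact ⟨fun ⟨i, hi⟩ => hi ▸ (e i).2, fun hx => ⟨e.symm ⟨x, hx⟩, by simp⟩⟩⟩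
  left_inv f := by ext; rfl
  right_inv e := by ext; rfl

lemma card_injective_image_eq {L : Type*} [DecidableEq L] (n : ℕ) (J : Finset L) :
    ENat.card {f : Fin n → L // Function.Injective f ∧ Finset.image f Finset.univ = J}
      = if n = J.card then (n.factorial : ℕ∞) else 0 := by
  rw [ENat.card_congr (injectiveImageEquiv n J), ENat.card_eq_coe_fintype_card]
  split_ifs with h
  · rw [Fintype.card_equiv (Fintype.equivOfCardEq (by simp [h]))]
    simp
  · have : IsEmpty (Fin n ≃ J) := ⟨fun e => h (by simpa using Fintype.card_congr e)⟩
    simp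

lemma tsum_injective_image {L : Type*} [DecidableEq L] (n : ℕ) (G : Finset L → ℝ≥0∞) :
    ∑' f : Fin n → L, (if Function.Injective f then G (Finset.image f Finset.univ) else 0)
      = ∑' J : Finset L, if n = J.card then (n.factorial : ℝ≥0∞) * G J else 0 := by
  have h (f : Fin n → L) :
      (if Function.Injective f then G (Finset.image f Finset.univ) else 0)
        = ∑' J : Finset L,
          {f : Fin n → L | Function.Injective f ∧ Finset.image f Finset.univ = J}.indicator
            (fun _ => G J) f := by
    rw [tsum_eq_single (Finset.image f Finset.univ)]
    · simp [Set.indicator_apply]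
    · intro J hJ
      simp [hJ.symm]
  simp_rw [h]
  rw [ENNReal.tsum_comm]
  congr 1 with J
  rw [← tsum_subtype, ENNReal.tsum_const]
  have hc := card_injective_image_eq n J
  simp only [Set.coe_ofPred]
  rw [hc]
  split_ifs <;> simp

/-- Grouping ordered families of distinct labels by their set of labels. -/
lemma tsum_inv_factorial_mul_tsum_injective_image {L : Type*} [DecidableEq L]
    (G : Finset L → ℝ≥0∞) :
    ∑' n : ℕ, (n.factorial : ℝ≥0∞)⁻¹ * ∑' f : Fin n → L,
        (if Function.Injective f then G (Finset.image f Finset.univ) else 0)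
      = ∑' J : Finset L, G J := by
  simp_rw [tsum_injective_image, ← ENNReal.tsum_mul_left]
  rw [ENNReal.tsum_comm]
  congr 1 with J
  rw [tsum_eq_single J.card]
  · rw [if_pos rfl, ← mul_assoc, ENNReal.inv_mul_cancel, one_mul]
    · exact_mod_cast Nat.factorial_ne_zero _
    · simp
  · intro n hn
    simp [hn]

/-- **Tonelli's theorem** for a product of functions of the separate coordinates. -/
lemma lintegral_fin_prod_eq_prod {n : ℕ} {E : Type*} [MeasurableSpace E]
    {μ : Fin n → Measure E} [∀ i, SigmaFinite (μ i)] {f : Fin n → E → ℝ≥0∞}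
    (hf : ∀ i, Measurable (f i)) :
    ∫⁻ x, ∏ i, f i (x i) ∂(Measure.pi μ) = ∏ i, ∫⁻ x, f i x ∂(μ i) := by
  induction n with
  | zero => simp
  | succ n ih =>
    have h_meas : Measurable fun x : Fin n → E => ∏ i, f i.succ (x i) :=
      Finset.measurable_prod _ fun i _ => (hf _).comp (measurable_pi_apply i)
    rw [← ((measurePreserving_piFinSuccAbove μ 0).symm).lintegral_comp_emb
      (MeasurableEquiv.measurableEmbedding _)]
    simp_rw [MeasurableEquiv.piFinSuccAbove_symm_apply, Fin.insertNthEquiv,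
      Fin.prod_univ_succ, Fin.insertNth_zero, Equiv.coe_fn_mk, Fin.cons_succ,
      Fin.zero_succAbove, cast_eq, Fin.cons_zero]
    rw [lintegral_prod_mul (hf 0).aemeasurable h_meas.aemeasurable, ih fun i => hf i.succ]

/-- Proposition 1: the void probability functional of a GLMB.
For a GLMB density `π(X) = Δ(X) ∑_c w⁽ᶜ⁾(L(X)) [p⁽ᶜ⁾]^X` and a measurable
region `S ⊆ 𝕏`, the set integral of `π` over `(𝕏 ∖ S) × 𝕃` equals
`∑_{L⊆𝕃} ∑_c w⁽ᶜ⁾(L) ∏_{ℓ∈L} ⟨1 − 1_S, p⁽ᶜ⁾(·,ℓ)⟩`, where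
`⟨1 − 1_S, p⁽ᶜ⁾(·,ℓ)⟩ = ∫_{𝕏∖S} p⁽ᶜ⁾(x,ℓ) dx`. -/
theorem glmb_void_probability
    {d : ℕ} {L ι : Type*} [Countable L] [DecidableEq L] [Fintype ι]
    (w : ι → Finset L → ℝ) (hw : ∀ c J, 0 ≤ w c J)
    (p : ι → (Fin d → ℝ) → L → ℝ)
    (hp0 : ∀ c x ℓ, 0 ≤ p c x ℓ)
    (hpm : ∀ c ℓ, Measurable fun x => p c x ℓ)
    (hp1 : ∀ c ℓ, ∫⁻ x, ENNReal.ofReal (p c x ℓ) = 1)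
    (hwsum : ∑' J : Finset L, ∑ c, ENNReal.ofReal (w c J) = 1)
    (S : Set (Fin d → ℝ)) (hS : MeasurableSet S) :
    ∑' n : ℕ, (Nat.factorial n : ℝ≥0∞)⁻¹ *
      ∑' ℓs : Fin n → L,
        ∫⁻ xs : Fin n → (Fin d → ℝ) in Set.univ.pi (fun _ => Sᶜ),
          ENNReal.ofReal ((if Function.Injective ℓs then (1:ℝ) else 0) *
            ∑ c, w c (Finset.image ℓs Finset.univ) * ∏ i, p c (xs i) (ℓs i))
    = ∑' J : Finset L, ∑ c, ENNReal.ofReal (w c J) *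
        ∏ ℓ ∈ J, ∫⁻ x in Sᶜ, ENNReal.ofReal (p c x ℓ) := by
  rw [← tsum_inv_factorial_mul_tsum_injective_image]
  congr! 5 with n f
  split_ifs with hf
  · have h_eq (xs : Fin n → (Fin d → ℝ)) :
        ENNReal.ofReal (1 * ∑ c, w c (Finset.image f Finset.univ) * ∏ i, p c (xs i) (f i))
          = ∑ c, ENNReal.ofReal (w c (Finset.image f Finset.univ)) *
            ∏ i, ENNReal.ofReal (p c (xs i) (f i)) := by
      rw [one_mul, ENNReal.ofReal_sum_of_nonneg fun c _ =>
        mul_nonneg (hw _ _) (Finset.prod_nonneg fun i _ => hp0 _ _ _)]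
      refine Finset.sum_congr rfl fun c _ => ?_
      rw [ENNReal.ofReal_mul (hw _ _), ENNReal.ofReal_prod_of_nonneg fun i _ => hp0 _ _ _]
    have h_meas (c : ι) : Measurable fun xs : Fin n → (Fin d → ℝ) =>
        ∏ i, ENNReal.ofReal (p c (xs i) (f i)) :=
      Finset.measurable_prod _ fun i _ =>
        ((hpm c (f i)).comp (measurable_pi_apply i)).ennreal_ofReal
    simp_rw [h_eq]
    rw [lintegral_finsetSum _ fun c _ => (h_meas c).const_mul _]
    refine Finset.sum_congr rfl fun c _ => ?_
    rw [lintegral_const_mul _ (h_meas c), volume_pi, Measure.restrict_pi_pi,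
      lintegral_fin_prod_eq_prod fun i => (hpm c (f i)).ennreal_ofReal,
      Finset.prod_image hf.injOn]
  · simp
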